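/- arXiv:1605.07897 — 2 statements merged into one kernel-verified Lean document; each statement's English description precedes it below -/
import Mathlib

section
/- Let E be a finite-dimensional real inner product space and F : E → ℝ∪{+∞} a closed convex function, three times continuously differentiable on its open convex effective domain dom F, with positive definite Hessian ∇²F(x) at every x ∈ dom F, and self-concordant with M = 2: |D³F(x)[u,u,u]| ≤ 2 (⟨∇²F(x)u,u⟩)^{3/2} for all x ∈ dom F, u ∈ E. Define ω(t) = t − ln(1 + t) for t > −1 and ω*(s) = −s − ln(1 − s) for s < 1 (the Legendre transform of ω). Then for all x, y ∈ dom F: F(y) − F(x) ≥ ⟨∇F(x), y − x⟩ + ω(‖y − x‖_x), and if ‖y − x‖_x < 1 then F(y) − F(x) ≤ ⟨∇F(x), y − x⟩ + ω*(‖y − x‖_x). -/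
open scoped Classical RealInnerProductSpace

/-- The Hessian quadratic form `⟨∇²F(x)u, u⟩` of `F` at `x` in direction `u`. -/
noncomputable def hessQ {E : Type*} [NormedAddCommGroup E] [NormedSpace ℝ E]
    (F : E → ℝ) (x u : E) : ℝ :=
  iteratedFDeriv ℝ 2 F x ![u, u]

/-- The third directional derivative `D³F(x)[u,u,u]`. -/
noncomputable def thirdD {E : Type*} [NormedAddCommGroup E] [NormedSpace ℝ E]
    (F : E → ℝ) (x u : E) : ℝ :=
  iteratedFDeriv ℝ 3 F x ![u, u, u]

/-- The local norm `‖u‖_x = ⟨∇²F(x)u, u⟩^{1/2}`. -/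
noncomputable def locNorm {E : Type*} [NormedAddCommGroup E] [NormedSpace ℝ E]
    (F : E → ℝ) (x u : E) : ℝ :=
  Real.sqrt (hessQ F x u)

/-- `ω(t) = t − ln(1+t)`. -/
noncomputable def scOmega (t : ℝ) : ℝ := t - Real.log (1 + t)

/-- `ω*(s) = −s − ln(1−s)`, the Legendre transform of `ω`. -/
noncomputable def scOmegaStar (s : ℝ) : ℝ := -s - Real.log (1 - s)

/-- A function vanishing at `0` with nonnegative derivative on `[0, 1]` is nonnegative there. -/
theorem nonneg_of_hasDerivAt_nonneg {h h' : ℝ → ℝ}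
    (hd : ∀ t ∈ Set.Icc (0 : ℝ) 1, HasDerivAt h (h' t) t) (h0 : h 0 = 0)
    (hn : ∀ t ∈ Set.Icc (0 : ℝ) 1, 0 ≤ h' t) : ∀ t ∈ Set.Icc (0 : ℝ) 1, 0 ≤ h t := by
  intro t ht
  have hm : MonotoneOn h (Set.Icc 0 1) := by
    refine monotoneOn_of_deriv_nonneg (convex_Icc 0 1)
      (fun s hs => (hd s hs).continuousAt.continuousWithinAt)
      (fun s hs => (hd s (interior_subset hs)).differentiableAt.differentiableWithinAt) ?_
    intro s hs
    rw [(hd s (interior_subset hs)).deriv]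
    exact hn s (interior_subset hs)
  have := hm ⟨le_rfl, zero_le_one⟩ ht ht.1
  rwa [h0] at this

theorem nonneg_of_second_deriv_nonneg {h h' h'' : ℝ → ℝ}
    (hd : ∀ t ∈ Set.Icc (0 : ℝ) 1, HasDerivAt h (h' t) t)
    (hd' : ∀ t ∈ Set.Icc (0 : ℝ) 1, HasDerivAt h' (h'' t) t) (h0 : h 0 = 0) (h0' : h' 0 = 0)
    (hn : ∀ t ∈ Set.Icc (0 : ℝ) 1, 0 ≤ h'' t) : 0 ≤ h 1 :=
  nonneg_of_hasDerivAt_nonneg hd h0 (nonneg_of_hasDerivAt_nonneg hd' h0' hn) 1 (by simp)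

theorem hasDerivAt_inv_sqrt_of_pos {q : ℝ → ℝ} {p t : ℝ} (hq : HasDerivAt q p t)
    (hpos : 0 < q t) :
    HasDerivAt (fun s => (√(q s))⁻¹) (-(p / (2 * √(q t))) / q t) t := by
  have h := (hq.sqrt hpos.ne').inv (Real.sqrt_pos.2 hpos).ne'
  rwa [Real.sq_sqrt hpos.le] at h

theorem abs_deriv_inv_sqrt_le_one {p a : ℝ} (ha : 0 < a)
    (h : |p| ≤ 2 * a ^ ((3 : ℝ) / 2)) : |-(p / (2 * √a)) / a| ≤ 1 := by
  have hs := Real.sqrt_pos.2 ha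
  have e : a ^ ((3 : ℝ) / 2) = a * √a := by
    rw [Real.sqrt_eq_rpow, show (3 : ℝ) / 2 = 1 + 1 / 2 by norm_num, Real.rpow_add ha,
      Real.rpow_one]
  rw [e] at h
  rw [neg_div, abs_neg, div_div, abs_div, abs_of_pos (by positivity : 0 < 2 * √a * a),
    div_le_one (by positivity)]
  linarith

section OneDim

variable {f f' q p : ℝ → ℝ}

theorem inv_sqrt_bounds
    (hq : ∀ t ∈ Set.Icc (0 : ℝ) 1, HasDerivAt q (p t) t)
    (hpos : ∀ t ∈ Set.Icc (0 : ℝ) 1, 0 < q t)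
    (hsc : ∀ t ∈ Set.Icc (0 : ℝ) 1, |p t| ≤ 2 * q t ^ ((3 : ℝ) / 2)) :
    ∀ t ∈ Set.Icc (0 : ℝ) 1,
      (√(q t))⁻¹ ≤ (√(q 0))⁻¹ + t ∧ (√(q 0))⁻¹ - t ≤ (√(q t))⁻¹ := by
  intro t ht
  have hb := fun s hs => abs_le.1 (abs_deriv_inv_sqrt_le_one (hpos s hs) (hsc s hs))
  have hd := fun s hs => hasDerivAt_inv_sqrt_of_pos (hq s hs) (hpos s hs)
  have h₁ := nonneg_of_hasDerivAt_nonneg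
    (h := fun s => (√(q 0))⁻¹ + s - (√(q s))⁻¹)
    (fun s hs => ((hasDerivAt_id s).const_add _).sub (hd s hs)) (by simp)
    (fun s hs => by linarith [(hb s hs).2]) t ht
  have h₂ := nonneg_of_hasDerivAt_nonneg
    (h := fun s => (√(q s))⁻¹ - ((√(q 0))⁻¹ - s))
    (fun s hs => (hd s hs).sub ((hasDerivAt_id s).const_sub _)) (by simp)
    (fun s hs => by linarith [(hb s hs).1]) t ht
  exact ⟨by simpa using h₁, by simpa using h₂⟩

theorem scOmega_bound_one_dim
    (hf : ∀ t ∈ Set.Icc (0 : ℝ) 1, HasDerivAt f (f' t) t)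
    (hf' : ∀ t ∈ Set.Icc (0 : ℝ) 1, HasDerivAt f' (q t) t)
    (hq : ∀ t ∈ Set.Icc (0 : ℝ) 1, HasDerivAt q (p t) t)
    (hpos : ∀ t ∈ Set.Icc (0 : ℝ) 1, 0 < q t)
    (hsc : ∀ t ∈ Set.Icc (0 : ℝ) 1, |p t| ≤ 2 * q t ^ ((3 : ℝ) / 2)) :
    f' 0 + scOmega √(q 0) ≤ f 1 - f 0 := by
  have hr : 0 < √(q 0) := Real.sqrt_pos.2 (hpos 0 (by simp))
  have hbound := inv_sqrt_bounds hq hpos hsc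
  set r := √(q 0)
  have hone : ∀ t ∈ Set.Icc (0 : ℝ) 1, 0 < 1 + r * t := fun t ht => by
    have := mul_nonneg hr.le ht.1; linarith
  have hlin : ∀ t : ℝ, HasDerivAt (fun s => 1 + r * s) r t := fun t => by
    simpa using ((hasDerivAt_id t).const_mul r).const_add 1
  have key := nonneg_of_second_deriv_nonneg
    (h := fun t => f t - (f 0 + f' 0 * t + (r * t - Real.log (1 + r * t))))
    (h' := fun t => f' t - (f' 0 + (r - r / (1 + r * t))))
    (h'' := fun t => q t - r ^ 2 / (1 + r * t) ^ 2)
    (fun t ht => by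
      refine ((hf t ht).sub ((((hasDerivAt_id t).const_mul (f' 0)).const_add (f 0)).add
        (((hasDerivAt_id t).const_mul r).sub ((hlin t).log (hone t ht).ne')))).congr_deriv ?_
      ring)
    (fun t ht => by
      refine ((hf' t ht).sub (((((hasDerivAt_const t r).div (hlin t)
        (hone t ht).ne').const_sub r).const_add (f' 0)))).congr_deriv ?_
      ring)
    (by simp) (by simp)
    (fun t ht => by
      have hs := Real.sqrt_pos.2 (hpos t ht)
      have h := (hbound t ht).1
      have hle : r / (1 + r * t) ≤ √(q t) := by
        have e : r⁻¹ + t = (1 + r * t) / r := by field_simp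
        rw [e] at h
        have := inv_anti₀ (inv_pos.2 hs) h
        rwa [inv_div, inv_inv] at this
      have := pow_le_pow_left₀ (div_nonneg hr.le (hone t ht).le) hle 2
      rw [Real.sq_sqrt (hpos t ht).le, div_pow] at this
      linarith)
  simp only [scOmega]
  simp only [mul_one] at key
  linarith

theorem scOmegaStar_bound_one_dim
    (hf : ∀ t ∈ Set.Icc (0 : ℝ) 1, HasDerivAt f (f' t) t)
    (hf' : ∀ t ∈ Set.Icc (0 : ℝ) 1, HasDerivAt f' (q t) t)
    (hq : ∀ t ∈ Set.Icc (0 : ℝ) 1, HasDerivAt q (p t) t)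
    (hpos : ∀ t ∈ Set.Icc (0 : ℝ) 1, 0 < q t)
    (hsc : ∀ t ∈ Set.Icc (0 : ℝ) 1, |p t| ≤ 2 * q t ^ ((3 : ℝ) / 2)) (hlt : √(q 0) < 1) :
    f 1 - f 0 ≤ f' 0 + scOmegaStar √(q 0) := by
  have hr : 0 < √(q 0) := Real.sqrt_pos.2 (hpos 0 (by simp))
  have hbound := inv_sqrt_bounds hq hpos hsc
  set r := √(q 0)
  have hone : ∀ t ∈ Set.Icc (0 : ℝ) 1, 0 < 1 - r * t := fun t ht => by
    have := mul_le_mul_of_nonneg_left ht.2 hr.le; linarith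
  have hlin : ∀ t : ℝ, HasDerivAt (fun s => 1 - r * s) (-r) t := fun t => by
    simpa using ((hasDerivAt_id t).const_mul r).const_sub 1
  have key := nonneg_of_second_deriv_nonneg
    (h := fun t => f 0 + f' 0 * t - (r * t + Real.log (1 - r * t)) - f t)
    (h' := fun t => f' 0 - (r - r / (1 - r * t)) - f' t)
    (h'' := fun t => r ^ 2 / (1 - r * t) ^ 2 - q t)
    (fun t ht => by
      refine (((((hasDerivAt_id t).const_mul (f' 0)).const_add (f 0)).sub
        (((hasDerivAt_id t).const_mul r).add ((hlin t).log (hone t ht).ne'))).sub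
        (hf t ht)).congr_deriv ?_
      ring)
    (fun t ht => by
      refine (((((hasDerivAt_const t r).div (hlin t)
        (hone t ht).ne').const_sub r).const_sub (f' 0)).sub (hf' t ht)).congr_deriv ?_
      ring)
    (by simp) (by simp)
    (fun t ht => by
      have h := (hbound t ht).2
      have hle : √(q t) ≤ r / (1 - r * t) := by
        have e : r⁻¹ - t = (1 - r * t) / r := by field_simp
        rw [e] at h
        have := inv_anti₀ (div_pos (hone t ht) hr) h
        rwa [inv_div, inv_inv] at this
      have := pow_le_pow_left₀ (Real.sqrt_nonneg _) hle 2
      rw [Real.sq_sqrt (hpos t ht).le, div_pow] at this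
      linarith)
  simp only [scOmegaStar]
  simp only [mul_one] at key
  linarith

end OneDim

/-- The derivative along a line of the `k`-th directional derivative is the `(k+1)`-st. -/
theorem hasDerivAt_iteratedFDeriv_line {E : Type*} [NormedAddCommGroup E] [NormedSpace ℝ E]
    {F : E → ℝ} {x u : E} {t : ℝ} {n : WithTop ℕ∞} {k : ℕ} (hF : ContDiffAt ℝ n F (x + t • u))
    (hk : (k : WithTop ℕ∞) < n) :
    HasDerivAt (fun s : ℝ => iteratedFDeriv ℝ k F (x + s • u) (fun _ => u))
      (iteratedFDeriv ℝ (k + 1) F (x + t • u) (fun _ => u)) t := by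
  have hd := (hF.differentiableAt_iteratedFDeriv hk).hasFDerivAt
  have hl : HasDerivAt (fun s : ℝ => x + s • u) u t := by
    simpa using ((hasDerivAt_id t).smul_const u).const_add x
  have h := hd.comp_hasDerivAt t hl
  have h2 := (ContinuousMultilinearMap.apply ℝ (fun _ : Fin k => E) ℝ
    (fun _ => u)).hasFDerivAt.comp_hasDerivAt t h
  rw [iteratedFDeriv_succ_apply_left]
  exact h2

/-- **Upper and lower bounds for a self-concordant function.** For a self-concordant
`F` (with `M = 2`) and `x, y ∈ dom F`,
`F(y) − F(x) ≥ ⟨∇F(x), y−x⟩ + ω(‖y−x‖_x)`, and if `‖y−x‖_x < 1` then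
`F(y) − F(x) ≤ ⟨∇F(x), y−x⟩ + ω*(‖y−x‖_x)`. -/
theorem sc_function_bounds {E : Type*} [NormedAddCommGroup E]
    [InnerProductSpace ℝ E] [FiniteDimensional ℝ E]
    (D : Set E) (hDo : IsOpen D) (hDc : Convex ℝ D)
    (F : E → ℝ)
    (hclosed : LowerSemicontinuous (fun x => if x ∈ D then (F x : EReal) else ⊤))
    (hconv : ConvexOn ℝ D F)
    (hF : ContDiffOn ℝ 3 F D)
    (hpos : ∀ x ∈ D, ∀ u : E, u ≠ 0 → 0 < hessQ F x u)
    (hsc : ∀ x ∈ D, ∀ u : E, |thirdD F x u| ≤ 2 * (hessQ F x u) ^ ((3 : ℝ) / 2)) :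
    ∀ x ∈ D, ∀ y ∈ D,
      F y - F x ≥ ⟪gradient F x, y - x⟫ + scOmega (locNorm F x (y - x)) ∧
      (locNorm F x (y - x) < 1 →
        F y - F x ≤ ⟪gradient F x, y - x⟫ + scOmegaStar (locNorm F x (y - x))) := by
  intro x hx y hy
  by_cases hxy : y = x
  · subst hxy
    have h0 : hessQ F y 0 = 0 := by
      unfold hessQ
      exact (iteratedFDeriv ℝ 2 F y).map_coord_zero 0 rfl
    simp [locNorm, h0, scOmega, scOmegaStar]
  have e2 : (![y - x, y - x] : Fin 2 → E) = fun _ => y - x := by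
    ext i; fin_cases i <;> rfl
  have e3 : (![y - x, y - x, y - x] : Fin 3 → E) = fun _ => y - x := by
    ext i; fin_cases i <;> rfl
  have hu : y - x ≠ 0 := sub_ne_zero.2 hxy
  have hmem : ∀ t ∈ Set.Icc (0 : ℝ) 1, x + t • (y - x) ∈ D := fun t ht =>
    hDc.add_smul_sub_mem hx hy ht
  have hC : ∀ t ∈ Set.Icc (0 : ℝ) 1, ContDiffAt ℝ 3 F (x + t • (y - x)) := fun t ht =>
    hF.contDiffAt (hDo.mem_nhds (hmem t ht))
  have hf : ∀ t ∈ Set.Icc (0 : ℝ) 1, HasDerivAt (fun s : ℝ => F (x + s • (y - x)))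
      (iteratedFDeriv ℝ 1 F (x + t • (y - x)) (fun _ => y - x)) t := fun t ht => by
    simpa using hasDerivAt_iteratedFDeriv_line (k := 0) (hC t ht) (by norm_num)
  have hf' : ∀ t ∈ Set.Icc (0 : ℝ) 1,
      HasDerivAt (fun s : ℝ => iteratedFDeriv ℝ 1 F (x + s • (y - x)) (fun _ => y - x))
        (hessQ F (x + t • (y - x)) (y - x)) t := fun t ht => by
    have h := hasDerivAt_iteratedFDeriv_line (k := 1) (hC t ht) (by norm_num)
    rwa [← e2] at h
  have hq : ∀ t ∈ Set.Icc (0 : ℝ) 1,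
      HasDerivAt (fun s : ℝ => hessQ F (x + s • (y - x)) (y - x))
        (thirdD F (x + t • (y - x)) (y - x)) t := fun t ht => by
    have h := hasDerivAt_iteratedFDeriv_line (k := 2) (hC t ht) (by norm_num)
    rwa [← e2, ← e3] at h
  have hp := fun t ht => hpos _ (hmem t ht) _ hu
  have hs := fun t ht => hsc _ (hmem t ht) (y - x)
  have hg : ⟪gradient F x, y - x⟫ = fderiv ℝ F x (y - x) := by
    simp [gradient]
  have lower := scOmega_bound_one_dim hf hf' hq hp hs
  have upper := scOmegaStar_bound_one_dim hf hf' hq hp hs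
  simp only [zero_smul, add_zero, one_smul, add_sub_cancel, iteratedFDeriv_one_apply] at lower upper
  rw [hg]
  exact ⟨lower, upper⟩
end

section
/- Let E be a finite-dimensional real inner product space and F : E → ℝ∪{+∞} a closed convex function, three times continuously differentiable on its open convex effective domain dom F, with positive definite Hessian ∇²F(x) at every x ∈ dom F, and self-concordant with M = 2: |D³F(x)[u,u,u]| ≤ 2 (⟨∇²F(x)u,u⟩)^{3/2} for all x ∈ dom F, u ∈ E. Define the Newton decrement λ(x) = ⟨(∇²F(x))^{−1}∇F(x), ∇F(x)⟩^{1/2}. Let x ∈ dom F with λ(x) < 1 and let x̂ = x − (∇²F(x))^{−1}∇F(x) be the full Newton iterate. Then x̂ ∈ dom F and λ(x̂) ≤ ( λ(x) / (1 − λ(x)) )². -/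
open scoped Classical RealInnerProductSpace

/-- The Hessian bilinear form `⟨∇²F(x)u, v⟩`. -/
noncomputable def hessB {E : Type*} [NormedAddCommGroup E] [NormedSpace ℝ E]
    (F : E → ℝ) (x u v : E) : ℝ :=
  iteratedFDeriv ℝ 2 F x ![u, v]

/-- If `f' ≤ g'` on `[0, t]` and `f 0 ≤ g 0`, then `f t ≤ g t`. -/
lemma le_of_hasDerivAt_le {f g f' g' : ℝ → ℝ} {t : ℝ} (ht : 0 ≤ t)
    (hf : ∀ s ∈ Set.Icc 0 t, HasDerivAt f (f' s) s)
    (hg : ∀ s ∈ Set.Icc 0 t, HasDerivAt g (g' s) s)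
    (h : ∀ s ∈ Set.Icc 0 t, f' s ≤ g' s) (h0 : f 0 ≤ g 0) : f t ≤ g t := by
  have hm : MonotoneOn (fun s => g s - f s) (Set.Icc 0 t) := by
    apply monotoneOn_of_hasDerivWithinAt_nonneg (convex_Icc 0 t) (f' := fun s => g' s - f' s)
    · intro s hs
      exact ((hg s hs).sub (hf s hs)).continuousAt.continuousWithinAt
    · intro s hs
      have hs' := interior_subset hs
      exact ((hg s hs').sub (hf s hs')).hasDerivWithinAt
    · intro s hs
      have := h s (interior_subset hs)
      linarith
  have := hm ⟨le_rfl, ht⟩ ⟨ht, le_rfl⟩ ht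
  simp only at this
  linarith

/-- A solution of `|r'| ≤ 2 r^{3/2}` starting at `a²` stays below `(a / (1 - t a))²`. -/
lemma sqrt_le_of_abs_deriv_le {r r' : ℝ → ℝ} {a t : ℝ} (ha : 0 < a) (ha1 : a < 1)
    (ht : 0 ≤ t) (ht1 : t ≤ 1) (hr0 : r 0 = a ^ 2)
    (hr : ∀ s ∈ Set.Icc 0 t, HasDerivAt r (r' s) s)
    (hpos : ∀ s ∈ Set.Icc 0 t, 0 < r s)
    (hb : ∀ s ∈ Set.Icc 0 t, r' s ≤ 2 * (r s * √(r s))) :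
    √(r t) ≤ a / (1 - t * a) := by
  have key : a⁻¹ - t ≤ (√(r t))⁻¹ := by
    apply le_of_hasDerivAt_le (f := fun s => a⁻¹ - s) (g := fun s => (√(r s))⁻¹)
      (f' := fun _ => -1) (g' := fun s => -(r' s / (2 * √(r s))) / (√(r s)) ^ 2) ht
    · intro s _
      simpa using (hasDerivAt_id s).const_sub a⁻¹
    · intro s hs
      exact ((hr s hs).sqrt (hpos s hs).ne').fun_inv (Real.sqrt_pos.2 (hpos s hs)).ne'
    · intro s hs
      have h1 := Real.sqrt_pos.2 (hpos s hs)
      have h2 := Real.sq_sqrt (hpos s hs).le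
      have h3 := hb s hs
      rw [neg_div, neg_le_neg_iff, div_div, div_le_one (by positivity)]
      rw [h2]
      linarith
    · simp [hr0, Real.sqrt_sq ha.le]
  have h1 := Real.sqrt_pos.2 (hpos t ⟨ht, le_rfl⟩)
  have hta : 0 < 1 - t * a := by nlinarith
  rw [le_div_iff₀ hta]
  have h2 : a * √(r t) * (a⁻¹ - t) ≤ a * √(r t) * (√(r t))⁻¹ :=
    mul_le_mul_of_nonneg_left key (by positivity)
  have h3 : a * √(r t) * (√(r t))⁻¹ = a := by field_simp
  have h4 : a * √(r t) * (a⁻¹ - t) = √(r t) * (1 - t * a) := by field_simp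
  linarith

section Trilinear

variable {E : Type*} [NormedAddCommGroup E] [NormedSpace ℝ E]

/-- Bound for a symmetric trilinear form on the plane spanned by an orthonormal pair `e, f`, with
the unit vectors given by the angles `-φ` and `2φ`, where `c = cos φ` and `s = sin φ`. -/
lemma trilinear_le_of_orthonormal (B : E →L[ℝ] E →L[ℝ] ℝ) (T : E →L[ℝ] E →L[ℝ] E →L[ℝ] ℝ)
    (hB : ∀ u v, B u v = B v u)
    (hT₁ : ∀ u v w, T u v w = T v u w) (hT₂ : ∀ u v w, T u v w = T u w v)
    (hT : ∀ u, |T u u u| ≤ 2 * (B u u * √(B u u)))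
    {e f : E} (he : B e e = 1) (hf : B f f = 1) (hef : B e f = 0)
    {c s : ℝ} (hcs : c ^ 2 + s ^ 2 = 1) :
    T (c • e - s • f) (c • e - s • f) ((c ^ 2 - s ^ 2) • e + (2 * c * s) • f) ≤ 2 := by
  have hunit : ∀ u, B u u = 1 → |T u u u| ≤ 2 := by
    intro u hu
    simpa [hu] using hT u
  have h3 : √3 ^ 2 = (3 : ℝ) := Real.sq_sqrt (by norm_num)
  have hfe : B f e = 0 := by rw [hB, hef]
  have e1 : T e f e = T e e f := hT₂ _ _ _
  have e2 : T f e e = T e e f := by rw [hT₁, hT₂]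
  have e3 : T f e f = T e f f := hT₁ _ _ _
  have e4 : T f f e = T e f f := by rw [hT₂, hT₁]
  have n0 := hunit e he
  have n1 := hunit ((1 / 2 : ℝ) • e + (√3 / 2) • f) (by
    simp [he, hf, hef, hfe]; linear_combination (1 / 4) * h3)
  have n2 := hunit ((1 / 2 : ℝ) • e - (√3 / 2) • f) (by
    simp [he, hf, hef, hfe]; linear_combination (1 / 4) * h3)
  simp only [map_add, map_sub, map_smul, add_apply,
    sub_apply, smul_apply, smul_eq_mul,
    e1, e2, e3, e4] at n0 n1 n2 ⊢
  generalize T e e e = x₀ at *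
  generalize T e e f = x₁ at *
  generalize T e f f = x₂ at *
  generalize T f f f = x₃ at *
  rw [abs_le] at n0 n1 n2
  set g := √(3 : ℝ)
  have p1 : -2 ≤ (x₀ + 3 * g * x₁ + 9 * x₂ + 3 * g * x₃) / 8 := by
    linear_combination n1.1 + (3 / 8 * x₂ + g / 8 * x₃) * h3
  have p2 : -2 ≤ (x₀ - 3 * g * x₁ + 9 * x₂ - 3 * g * x₃) / 8 := by
    linear_combination n2.1 + (3 / 8 * x₂ - g / 8 * x₃) * h3
  have m0 := mul_le_mul_of_nonneg_left n0.2 (sq_nonneg (3 * c ^ 2 - s ^ 2))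
  have m1 := mul_le_mul_of_nonneg_left p1 (sq_nonneg (2 * s * (s - g * c)))
  have m2 := mul_le_mul_of_nonneg_left p2 (sq_nonneg (2 * s * (s + g * c)))
  have hcs' : (c ^ 2 + s ^ 2) ^ 2 = 1 := by rw [hcs]; norm_num
  linear_combination (1 / 9) * m0 + (1 / 9) * m1 + (1 / 9) * m2 + 2 * hcs'
    + (16 / 9 * s ^ 2 * c ^ 2 - 1 / 3 * (2 * s ^ 3 * c * (x₁ + x₃))
      + (x₀ + 9 * x₂) / 9 * s ^ 2 * c ^ 2) * h3

/-- A symmetric trilinear form bounded by `2` on the diagonal of the unit sphere satisfies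
`T u u v ≤ 2` for unit vectors `u`, `v`. -/
lemma trilinear_le_of_unit (B : E →L[ℝ] E →L[ℝ] ℝ) (T : E →L[ℝ] E →L[ℝ] E →L[ℝ] ℝ)
    (hB : ∀ u v, B u v = B v u) (hBpos : ∀ u, u ≠ 0 → 0 < B u u)
    (hT₁ : ∀ u v w, T u v w = T v u w) (hT₂ : ∀ u v w, T u v w = T u w v)
    (hT : ∀ u, |T u u u| ≤ 2 * (B u u * √(B u u)))
    {u v : E} (hu : B u u = 1) (hv : B v v = 1) : T u u v ≤ 2 := by
  have hTu := hT u
  simp only [hu, Real.sqrt_one, mul_one] at hTu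
  rw [abs_le] at hTu
  by_cases h1 : u = v
  · rw [← h1]; exact hTu.2
  by_cases h2 : u = -v
  · rw [eq_neg_iff_add_eq_zero, add_comm, ← eq_neg_iff_add_eq_zero] at h2
    rw [h2, map_neg]; linarith [hTu.1]
  have hk1 : B u v < 1 := by
    have := hBpos (u - v) (sub_ne_zero.2 h1)
    simp [hu, hv, hB v u] at this
    linarith
  have hk2 : -1 < B u v := by
    have := hBpos (u + v) (fun h => h2 (eq_neg_of_add_eq_zero_left h))
    simp [hu, hv, hB v u] at this
    linarith
  obtain ⟨c, s, hcs, hc⟩ : ∃ c s : ℝ, c ^ 2 + s ^ 2 = 1 ∧ 4 * c ^ 3 - 3 * c = B u v := by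
    refine ⟨Real.cos (Real.arccos (B u v) / 3), Real.sin (Real.arccos (B u v) / 3),
      Real.cos_sq_add_sin_sq _, ?_⟩
    rw [← Real.cos_three_mul, mul_div_cancel₀ _ (by norm_num), Real.cos_arccos hk2.le hk1.le]
  set k := B u v with hk
  have hvu : B v u = k := by rw [hB]
  obtain ⟨S, hS⟩ : ∃ S, S = 3 * c ^ 2 * s - s ^ 3 := ⟨_, rfl⟩
  have hk' : k = c ^ 3 - 3 * c * s ^ 2 := by linear_combination -hc + 3 * c * hcs
  have hSk : S ^ 2 = 1 - k ^ 2 := by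
    have h6 : (c ^ 2 + s ^ 2) ^ 3 = 1 := by rw [hcs]; norm_num
    rw [hk', hS]; linear_combination h6
  have hS0 : S ≠ 0 := by
    rintro rfl
    nlinarith
  have hSS : S⁻¹ * S = 1 := inv_mul_cancel₀ hS0
  have hs2 : s ^ 2 = 1 - c ^ 2 := by linear_combination hcs
  have hS' : S = s * (4 * c ^ 2 - 1) := by rw [hS]; linear_combination -s * hcs
  have key := trilinear_le_of_orthonormal B T hB hT₁ hT₂ hT
    (e := S⁻¹ • ((2 * c * s) • u + s • v))
    (f := S⁻¹ • (c • v - (c ^ 2 - s ^ 2) • u)) (c := c) (s := s) ?_ ?_ ?_ hcs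
  · convert key using 2
    · have : c • S⁻¹ • ((2 * c * s) • u + s • v) - s • S⁻¹ • (c • v - (c ^ 2 - s ^ 2) • u)
        = (S⁻¹ * S) • u := by rw [hS]; module
      rw [this, hSS, one_smul]
    · have : (c ^ 2 - s ^ 2) • S⁻¹ • ((2 * c * s) • u + s • v)
          + (2 * c * s) • S⁻¹ • (c • v - (c ^ 2 - s ^ 2) • u) = (S⁻¹ * S) • v := by
        rw [hS]; module
      rw [this, hSS, one_smul]
  · simp [hu, hv, ← hk, hvu]
    field_simp
    rw [hS', mul_pow, hs2, ← hc]; ring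
  · simp [hu, hv, ← hk, hvu]
    field_simp
    rw [hS', mul_pow, hs2, ← hc]; ring
  · simp [hu, hv, ← hk, hvu]
    field_simp
    right; rw [hs2, ← hc]; ring

/-- Generalized Cauchy-Schwarz inequality for symmetric trilinear forms. -/
lemma trilinear_le (B : E →L[ℝ] E →L[ℝ] ℝ) (T : E →L[ℝ] E →L[ℝ] E →L[ℝ] ℝ)
    (hB : ∀ u v, B u v = B v u) (hBpos : ∀ u, u ≠ 0 → 0 < B u u)
    (hT₁ : ∀ u v w, T u v w = T v u w) (hT₂ : ∀ u v w, T u v w = T u w v)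
    (hT : ∀ u, |T u u u| ≤ 2 * (B u u * √(B u u))) (u v : E) :
    T u u v ≤ 2 * (B u u * √(B v v)) := by
  by_cases hu : u = 0
  · simp [hu]
  by_cases hv : v = 0
  · simp [hv]
  have h1 := hBpos u hu
  have h2 := hBpos v hv
  have s1 := Real.sqrt_pos.2 h1
  have s2 := Real.sqrt_pos.2 h2
  have q1 := Real.mul_self_sqrt h1.le
  have q2 := Real.mul_self_sqrt h2.le
  have key := trilinear_le_of_unit B T hB hBpos hT₁ hT₂ hT
    (u := (√(B u u))⁻¹ • u) (v := (√(B v v))⁻¹ • v)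
    (by simp only [map_smul, smul_apply, smul_eq_mul]
        rw [← mul_assoc, ← mul_inv, q1, inv_mul_cancel₀ h1.ne'])
    (by simp only [map_smul, smul_apply, smul_eq_mul]
        rw [← mul_assoc, ← mul_inv, q2, inv_mul_cancel₀ h2.ne'])
  simp only [map_smul, smul_apply, smul_eq_mul] at key
  set a := √(B u u)
  set b := √(B v v)
  calc T u u v = a * a * b * (b⁻¹ * (a⁻¹ * (a⁻¹ * T u u v))) := by field_simp
    _ ≤ a * a * b * 2 := mul_le_mul_of_nonneg_left key (by positivity)
    _ = 2 * (B u u * b) := by rw [q1]; ring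

end Trilinear
section Line

variable {E : Type*} [NormedAddCommGroup E] [NormedSpace ℝ E]

lemma HasFDerivAt.hasDerivAt_sub_smul {g : E → ℝ} {g' : E →L[ℝ] ℝ} {x p : E} {t : ℝ}
    (hg : HasFDerivAt g g' (x - t • p)) : HasDerivAt (fun s => g (x - s • p)) (-(g' p)) t := by
  have h1 : HasDerivAt (fun s : ℝ => x - s • p) (-p) t := by
    simpa using ((hasDerivAt_id t).smul_const p).const_sub x
  rw [← map_neg]
  exact hg.comp_hasDerivAt t h1

variable {F : E → ℝ} {x p : E} {t : ℝ}

lemma hessB_eq_fderiv (F : E → ℝ) (y u v : E) :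
    hessB F y u v = fderiv ℝ (fderiv ℝ F) y u v := by
  simp [hessB, iteratedFDeriv_two_apply]

lemma hessQ_eq_fderiv (F : E → ℝ) (y u : E) :
    hessQ F y u = fderiv ℝ (fderiv ℝ F) y u u := by
  simp [hessQ, iteratedFDeriv_two_apply]

lemma thirdD_eq_fderiv (F : E → ℝ) (y u : E) :
    thirdD F y u = fderiv ℝ (fderiv ℝ (fderiv ℝ F)) y u u u := by
  rw [thirdD, iteratedFDeriv_succ_apply_right, iteratedFDeriv_two_apply]
  rfl

lemma ContDiffAt.hasDerivAt_line (hF : ContDiffAt ℝ 3 F (x - t • p)) :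
    HasDerivAt (fun s => F (x - s • p)) (-(fderiv ℝ F (x - t • p) p)) t :=
  (hF.differentiableAt (by norm_num)).hasFDerivAt.hasDerivAt_sub_smul

lemma ContDiffAt.hasDerivAt_fderiv_line (hF : ContDiffAt ℝ 3 F (x - t • p)) (v : E) :
    HasDerivAt (fun s => fderiv ℝ F (x - s • p) v)
      (-(fderiv ℝ (fderiv ℝ F) (x - t • p) p v)) t := by
  have h : ContDiffAt ℝ 2 (fderiv ℝ F) (x - t • p) := hF.fderiv_right (by norm_num)
  have h1 := (h.differentiableAt (by norm_num)).hasFDerivAt.clm_apply (hasFDerivAt_const v _)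
  simpa using h1.hasDerivAt_sub_smul

lemma ContDiffAt.hasFDerivAt_fderiv_fderiv {y : E} (hF : ContDiffAt ℝ 3 F y) (u v : E) :
    HasFDerivAt (fun z => fderiv ℝ (fderiv ℝ F) z u v)
      (((fderiv ℝ (fderiv ℝ (fderiv ℝ F)) y).flip u).flip v) y := by
  have h : ContDiffAt ℝ 2 (fderiv ℝ F) y := hF.fderiv_right (by norm_num)
  have h' : ContDiffAt ℝ 1 (fderiv ℝ (fderiv ℝ F)) y := h.fderiv_right (by norm_num)
  have h1 := ((h'.differentiableAt (by norm_num)).hasFDerivAt.clm_apply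
    (hasFDerivAt_const u _)).clm_apply (hasFDerivAt_const v _)
  simpa using h1

lemma ContDiffAt.hasDerivAt_hess_line (hF : ContDiffAt ℝ 3 F (x - t • p)) (u v : E) :
    HasDerivAt (fun s => fderiv ℝ (fderiv ℝ F) (x - s • p) u v)
      (-(fderiv ℝ (fderiv ℝ (fderiv ℝ F)) (x - t • p) p u v)) t := by
  simpa using (hF.hasFDerivAt_fderiv_fderiv u v).hasDerivAt_sub_smul

lemma ContDiffAt.fderiv_fderiv_comm {y : E} (hF : ContDiffAt ℝ 3 F y) (u v : E) :
    fderiv ℝ (fderiv ℝ F) y u v = fderiv ℝ (fderiv ℝ F) y v u :=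
  hF.isSymmSndFDerivAt (by simp; norm_num) u v

lemma ContDiffAt.third_fderiv_comm_left {y : E} (hF : ContDiffAt ℝ 3 F y) (u v w : E) :
    fderiv ℝ (fderiv ℝ (fderiv ℝ F)) y u v w = fderiv ℝ (fderiv ℝ (fderiv ℝ F)) y v u w := by
  have h : ContDiffAt ℝ 2 (fderiv ℝ F) y := hF.fderiv_right (by norm_num)
  rw [h.isSymmSndFDerivAt (by simp) u v]

lemma ContDiffAt.third_fderiv_comm_right {y : E} (hF : ContDiffAt ℝ 3 F y) (u v w : E) :
    fderiv ℝ (fderiv ℝ (fderiv ℝ F)) y u v w = fderiv ℝ (fderiv ℝ (fderiv ℝ F)) y u w v := by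
  have h1 := hF.hasFDerivAt_fderiv_fderiv v w
  have h2 := hF.hasFDerivAt_fderiv_fderiv w v
  have heq : (fun z => fderiv ℝ (fderiv ℝ F) z v w) =ᶠ[nhds y]
      fun z => fderiv ℝ (fderiv ℝ F) z w v := by
    filter_upwards [hF.eventually (by simp)] with z hz using hz.fderiv_fderiv_comm v w
  simpa using DFunLike.congr_fun (h1.unique (h2.congr_of_eventuallyEq heq)) u

/-- The segment of a self-concordant function in a direction `p` of local length less than one
stays in the domain. -/
lemma sub_smul_mem_of_selfConcordant {D : Set E} (hDo : IsOpen D)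
    (hclosed : LowerSemicontinuous (fun x => if x ∈ D then (F x : EReal) else ⊤))
    (hF : ∀ y ∈ D, ContDiffAt ℝ 3 F y)
    (hpos : ∀ y ∈ D, 0 < fderiv ℝ (fderiv ℝ F) y p p)
    (hsc : ∀ y ∈ D, |fderiv ℝ (fderiv ℝ (fderiv ℝ F)) y p p p| ≤
      2 * (fderiv ℝ (fderiv ℝ F) y p p * √(fderiv ℝ (fderiv ℝ F) y p p)))
    (hx : x ∈ D) {a : ℝ} (ha : 0 < a) (ha1 : a < 1)
    (hax : fderiv ℝ (fderiv ℝ F) x p p = a ^ 2) :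
    ∀ t ∈ Set.Icc (0 : ℝ) 1, x - t • p ∈ D := by
  by_contra! hcon
  have hline : Continuous fun t : ℝ => x - t • p := by fun_prop
  have hcomp : IsCompact (Set.Icc (0 : ℝ) 1 ∩ (fun t : ℝ => x - t • p) ⁻¹' Dᶜ) :=
    isCompact_Icc.inter_right (hDo.isClosed_compl.preimage hline)
  obtain ⟨τ, ⟨hτ, hτD⟩, hleast⟩ := hcomp.exists_isLeast hcon
  have hτD' : x - τ • p ∉ D := hτD
  have hτ0 : 0 < τ := by
    rcases hτ.1.lt_or_eq with h | h
    · exact h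
    · rw [← h] at hτD'; simp [hx] at hτD'
  have hmem : ∀ s, 0 ≤ s → s < τ → x - s • p ∈ D := by
    intro s hs hsτ
    by_contra hsD
    exact absurd (hleast ⟨⟨hs, hsτ.le.trans hτ.2⟩, hsD⟩) (not_le.2 hsτ)
  set b := a / (1 - a)
  have hr : ∀ s, 0 ≤ s → s < τ → fderiv ℝ (fderiv ℝ F) (x - s • p) p p ≤ b ^ 2 := by
    intro s hs hsτ
    have hs1 : s ≤ 1 := hsτ.le.trans hτ.2
    have h1 := sqrt_le_of_abs_deriv_le ha ha1 hs hs1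
      (r := fun s => fderiv ℝ (fderiv ℝ F) (x - s • p) p p) (by simpa using hax)
      (fun u hu => (hF _ (hmem u hu.1 (hu.2.trans_lt hsτ))).hasDerivAt_hess_line p p)
      (fun u hu => hpos _ (hmem u hu.1 (hu.2.trans_lt hsτ)))
      (fun u hu => (neg_le_abs _).trans (hsc _ (hmem u hu.1 (hu.2.trans_lt hsτ))))
    have h2 : a / (1 - s * a) ≤ b := by
      apply div_le_div_of_nonneg_left ha.le (by linarith) (by nlinarith)
    exact (Real.sqrt_le_left (div_nonneg ha.le (by linarith))).1 (h1.trans h2)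
  set K := |fderiv ℝ F x p| + b ^ 2
  have hK0 : 0 ≤ K := by positivity
  have hφ' : ∀ s, 0 ≤ s → s < τ → -(fderiv ℝ F (x - s • p) p) ≤ K := by
    intro s hs hsτ
    have := le_of_hasDerivAt_le hs (f := fun s => -(fderiv ℝ F (x - s • p) p))
      (g := fun s => |fderiv ℝ F x p| + s * b ^ 2) (g' := fun _ => b ^ 2)
      (fun u hu => ((hF _ (hmem u hu.1 (hu.2.trans_lt hsτ))).hasDerivAt_fderiv_line p).neg)
      (fun u _ => (hasDerivAt_mul_const (b ^ 2)).const_add _)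
      (fun u hu => by simpa using hr u hu.1 (hu.2.trans_lt hsτ))
      (by simpa using neg_le_abs (fderiv ℝ F x p))
    nlinarith [sq_nonneg b, hτ.2]
  have hφ : ∀ s, 0 ≤ s → s < τ → F (x - s • p) ≤ F x + K := by
    intro s hs hsτ
    have := le_of_hasDerivAt_le hs (f := fun s => F (x - s • p))
      (g := fun s => F x + s * K) (g' := fun _ => K)
      (fun u hu => (hF _ (hmem u hu.1 (hu.2.trans_lt hsτ))).hasDerivAt_line)
      (fun u _ => (hasDerivAt_mul_const K).const_add _)
      (fun u hu => hφ' u hu.1 (hu.2.trans_lt hsτ)) (by simp)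
    nlinarith [hτ.2]
  have hev := hclosed (x - τ • p) ((F x + K : ℝ) : EReal) (by
    simp only [if_neg hτD']; exact EReal.coe_lt_top _)
  have hev' := (hline.tendsto τ).eventually hev
  obtain ⟨s, ⟨hs, hs0⟩, hsτ⟩ := (((hev'.filter_mono nhdsWithin_le_nhds).and
    (Filter.Eventually.filter_mono nhdsWithin_le_nhds (lt_mem_nhds hτ0))).and
    (self_mem_nhdsWithin : Set.Iio τ ∈ nhdsWithin τ (Set.Iio τ))).exists
  simp only [if_pos (hmem s hs0.le hsτ), EReal.coe_lt_coe_iff] at hs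
  exact absurd (hφ s hs0.le hsτ) (not_le.2 hs)

end Line

section Newton

variable {E : Type*} [NormedAddCommGroup E] [NormedSpace ℝ E] {F : E → ℝ} {x p : E} {a : ℝ}

lemma hasDerivAt_inv_one_sub_mul {s a : ℝ} (h : 0 < 1 - s * a) :
    HasDerivAt (fun u : ℝ => (1 - u * a)⁻¹) (a * ((1 - s * a)⁻¹) ^ 2) s := by
  have := ((hasDerivAt_mul_const (x := s) a).const_sub 1).fun_inv h.ne'
  rwa [neg_neg, div_eq_mul_inv, ← inv_pow] at this

/-- If `a < 1` bounds the local length of `p` as `a / (1 - t a)` along the segment, then the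
Hessian decreases at most by the factor `(1 - t a)²`. -/
lemma hess_lower_bound {D : Set E} (ha : 0 < a) (ha1 : a < 1)
    (hF : ∀ y ∈ D, ContDiffAt ℝ 3 F y)
    (hmem : ∀ t ∈ Set.Icc (0 : ℝ) 1, x - t • p ∈ D)
    (htri : ∀ y ∈ D, ∀ u v, fderiv ℝ (fderiv ℝ (fderiv ℝ F)) y u u v ≤
      2 * (fderiv ℝ (fderiv ℝ F) y u u * √(fderiv ℝ (fderiv ℝ F) y v v)))
    (hnn : ∀ y ∈ D, ∀ u, 0 ≤ fderiv ℝ (fderiv ℝ F) y u u)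
    (hp : ∀ t ∈ Set.Icc (0 : ℝ) 1,
      √(fderiv ℝ (fderiv ℝ F) (x - t • p) p p) ≤ a * (1 - t * a)⁻¹) (v : E) :
    fderiv ℝ (fderiv ℝ F) x v v * (1 - a) ^ 2 ≤ fderiv ℝ (fderiv ℝ F) (x - p) v v := by
  have key := le_of_hasDerivAt_le zero_le_one (f := fun _ => fderiv ℝ (fderiv ℝ F) x v v)
    (g := fun s => fderiv ℝ (fderiv ℝ F) (x - s • p) v v * ((1 - s * a)⁻¹) ^ 2)
    (fun s _ => hasDerivAt_const s _)
    (fun s hs => ((hF _ (hmem s hs)).hasDerivAt_hess_line v v).mul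
      ((hasDerivAt_inv_one_sub_mul (by nlinarith [hs.1, hs.2])).fun_pow 2))
    (fun s hs => ?_) (by simp)
  · have h1 : (1 - a) * (1 - a)⁻¹ = 1 := mul_inv_cancel₀ (by linarith)
    simp only [one_smul, one_mul] at key
    calc fderiv ℝ (fderiv ℝ F) x v v * (1 - a) ^ 2
        ≤ fderiv ℝ (fderiv ℝ F) (x - p) v v * ((1 - a)⁻¹) ^ 2 * (1 - a) ^ 2 :=
          mul_le_mul_of_nonneg_right key (sq_nonneg _)
      _ = fderiv ℝ (fderiv ℝ F) (x - p) v v * ((1 - a) * (1 - a)⁻¹) ^ 2 := by ring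
      _ = _ := by rw [h1]; ring
  · have hy := hmem s hs
    have h1 := htri _ hy v p
    rw [(hF _ hy).third_fderiv_comm_right v v p, (hF _ hy).third_fderiv_comm_left v p v] at h1
    have h2 := mul_le_mul_of_nonneg_left (hp s hs) (hnn _ hy v)
    have h3 := mul_le_mul_of_nonneg_right (h1.trans (mul_le_mul_of_nonneg_left h2 zero_le_two))
      (sq_nonneg (1 - s * a)⁻¹)
    norm_num
    simp only [← inv_pow]
    linarith

/-- If `a < 1` bounds the local length of `p` as `a / (1 - t a)` along the segment, then the
Hessian grows at most by the factor `(1 - t a)⁻²`. -/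
lemma hess_upper_bound {D : Set E} (ha : 0 < a) (ha1 : a < 1)
    (hF : ∀ y ∈ D, ContDiffAt ℝ 3 F y)
    (hmem : ∀ t ∈ Set.Icc (0 : ℝ) 1, x - t • p ∈ D)
    (htri : ∀ y ∈ D, ∀ u v, fderiv ℝ (fderiv ℝ (fderiv ℝ F)) y u u v ≤
      2 * (fderiv ℝ (fderiv ℝ F) y u u * √(fderiv ℝ (fderiv ℝ F) y v v)))
    (hnn : ∀ y ∈ D, ∀ u, 0 ≤ fderiv ℝ (fderiv ℝ F) y u u)
    (hp : ∀ t ∈ Set.Icc (0 : ℝ) 1,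
      √(fderiv ℝ (fderiv ℝ F) (x - t • p) p p) ≤ a * (1 - t * a)⁻¹)
    (v : E) {t : ℝ} (ht : t ∈ Set.Icc (0 : ℝ) 1) :
    √(fderiv ℝ (fderiv ℝ F) (x - t • p) v v) ≤
      √(fderiv ℝ (fderiv ℝ F) x v v) * (1 - t * a)⁻¹ := by
  have hta : ∀ s ∈ Set.Icc (0 : ℝ) t, 0 < 1 - s * a := fun s hs => by
    nlinarith [hs.1, hs.2, ht.2]
  have hsub : ∀ s ∈ Set.Icc (0 : ℝ) t, s ∈ Set.Icc (0 : ℝ) 1 := fun s hs => ⟨hs.1, hs.2.trans ht.2⟩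
  have key := le_of_hasDerivAt_le ht.1
    (f := fun s => fderiv ℝ (fderiv ℝ F) (x - s • p) v v * (1 - s * a) ^ 2)
    (g := fun _ => fderiv ℝ (fderiv ℝ F) x v v)
    (fun s hs => ((hF _ (hmem s (hsub s hs))).hasDerivAt_hess_line v v).mul
      (((hasDerivAt_mul_const (x := s) a).const_sub 1).fun_pow 2))
    (fun s _ => hasDerivAt_const s _)
    (fun s hs => ?_) (by simp)
  · have hw := hta t ⟨ht.1, le_rfl⟩
    rw [← div_eq_mul_inv, le_div_iff₀ hw]
    apply Real.le_sqrt_of_sq_le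
    rw [mul_pow, Real.sq_sqrt (hnn _ (hmem t ht) v)]
    exact key
  · have hy := hmem s (hsub s hs)
    have hw := hta s hs
    have h1 := htri _ hy v (-p)
    simp only [map_neg, neg_apply, neg_neg] at h1
    rw [(hF _ hy).third_fderiv_comm_right v v p, (hF _ hy).third_fderiv_comm_left v p v] at h1
    have h2 := mul_le_mul_of_nonneg_left (hp s (hsub s hs)) (hnn _ hy v)
    have h3 := mul_le_mul_of_nonneg_right (h1.trans (mul_le_mul_of_nonneg_left h2 zero_le_two))
      (sq_nonneg (1 - s * a))
    have h4 : 2 * (fderiv ℝ (fderiv ℝ F) (x - s • p) v v * (a * (1 - s * a)⁻¹)) * (1 - s * a) ^ 2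
        = 2 * fderiv ℝ (fderiv ℝ F) (x - s • p) v v * a * (1 - s * a) := by
      field_simp
    norm_num
    linarith

/-- The dual local norm at `x` of the gradient at the Newton iterate is at most
`a² / (1 - a)`. -/
lemma fderiv_newton_le {D : Set E} (ha : 0 < a) (ha1 : a < 1)
    (hF : ∀ y ∈ D, ContDiffAt ℝ 3 F y)
    (hmem : ∀ t ∈ Set.Icc (0 : ℝ) 1, x - t • p ∈ D)
    (htri : ∀ y ∈ D, ∀ u v, fderiv ℝ (fderiv ℝ (fderiv ℝ F)) y u u v ≤
      2 * (fderiv ℝ (fderiv ℝ F) y u u * √(fderiv ℝ (fderiv ℝ F) y v v)))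
    (hnn : ∀ y ∈ D, ∀ u, 0 ≤ fderiv ℝ (fderiv ℝ F) y u u)
    (hp : ∀ t ∈ Set.Icc (0 : ℝ) 1,
      √(fderiv ℝ (fderiv ℝ F) (x - t • p) p p) ≤ a * (1 - t * a)⁻¹)
    (hnewton : ∀ v, fderiv ℝ (fderiv ℝ F) x p v = fderiv ℝ F x v) (q : E) :
    fderiv ℝ F (x - p) q ≤ a ^ 2 / (1 - a) * √(fderiv ℝ (fderiv ℝ F) x q q) := by
  set N := √(fderiv ℝ (fderiv ℝ F) x q q) with hN
  have hta : ∀ s ∈ Set.Icc (0 : ℝ) 1, 0 < 1 - s * a := fun s hs => by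
    nlinarith [hs.1, hs.2]
  have hfirst : ∀ t ∈ Set.Icc (0 : ℝ) 1,
      fderiv ℝ F x q - fderiv ℝ (fderiv ℝ F) (x - t • p) p q ≤
        a * N * ((1 - t * a)⁻¹) ^ 2 - a * N := by
    intro t ht
    have hsub : ∀ s ∈ Set.Icc (0 : ℝ) t, s ∈ Set.Icc (0 : ℝ) 1 :=
      fun s hs => ⟨hs.1, hs.2.trans ht.2⟩
    refine le_of_hasDerivAt_le ht.1
      (f := fun s => fderiv ℝ F x q - fderiv ℝ (fderiv ℝ F) (x - s • p) p q)
      (g := fun s => a * N * ((1 - s * a)⁻¹) ^ 2 - a * N)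
      (fun s hs => ((hF _ (hmem s (hsub s hs))).hasDerivAt_hess_line p q).const_sub _)
      (fun s hs => (((hasDerivAt_inv_one_sub_mul (hta s (hsub s hs))).fun_pow 2).const_mul
        (a * N)).sub_const _)
      (fun s hs => ?_) (by simp [hnewton])
    have hs' := hsub s hs
    have hy := hmem s hs'
    have hw := inv_pos.2 (hta s hs')
    have h1 := htri _ hy p q
    have h2 := hp s hs'
    have h3 := hess_upper_bound ha ha1 hF hmem htri hnn hp q hs'
    have h4 : fderiv ℝ (fderiv ℝ F) (x - s • p) p p ≤ (a * (1 - s * a)⁻¹) ^ 2 :=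
      (Real.sqrt_le_left (by positivity)).1 h2
    have h5 := mul_le_mul h4 h3 (Real.sqrt_nonneg _) (by positivity)
    norm_num
    simp only [← inv_pow]
    rw [← hN] at h5
    linarith
  have hsecond := le_of_hasDerivAt_le zero_le_one
    (f := fun s => fderiv ℝ F (x - s • p) q + s * fderiv ℝ F x q)
    (g := fun s => N * (1 - s * a)⁻¹ - s * (a * N) + (fderiv ℝ F x q - N))
    (fun s hs => ((hF _ (hmem s hs)).hasDerivAt_fderiv_line q).add (hasDerivAt_mul_const _))
    (fun s hs => (((hasDerivAt_inv_one_sub_mul (hta s hs)).const_mul N).sub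
      (hasDerivAt_mul_const _)).add_const _)
    (fun s hs => by linarith [hfirst s hs]) (by simp)
  simp only [one_smul, one_mul] at hsecond
  have h1a : 1 - a ≠ 0 := by linarith
  have : a ^ 2 / (1 - a) * N = N * (1 - a)⁻¹ - a * N - N := by
    field_simp
    ring
  linarith

end Newton

lemma Real.rpow_three_halves {r : ℝ} (hr : 0 ≤ r) : r ^ ((3 : ℝ) / 2) = r * √r := by
  rw [show (3 : ℝ) / 2 = 1 + 1 / 2 by norm_num, Real.rpow_add' hr (by norm_num), Real.rpow_one,
    ← Real.sqrt_eq_rpow]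

/-- **Quadratic convergence of the Newton step for self-concordant functions.**
Let `λ(x) = ⟨(∇²F(x))⁻¹∇F(x), ∇F(x)⟩^{1/2} < 1` (here `p` is the Newton direction,
`∇²F(x)p = ∇F(x)`, so `λ(x) = ⟨∇F(x), p⟩^{1/2}`).  Then the full Newton iterate
`x̂ = x − p` lies in `dom F` and `λ(x̂) ≤ (λ(x)/(1−λ(x)))²`. -/
theorem sc_newton_step {E : Type*} [NormedAddCommGroup E]
    [InnerProductSpace ℝ E] [FiniteDimensional ℝ E]
    (D : Set E) (hDo : IsOpen D) (hDc : Convex ℝ D)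
    (F : E → ℝ)
    (hclosed : LowerSemicontinuous (fun x => if x ∈ D then (F x : EReal) else ⊤))
    (hconv : ConvexOn ℝ D F)
    (hF : ContDiffOn ℝ 3 F D)
    (hpos : ∀ x ∈ D, ∀ u : E, u ≠ 0 → 0 < hessQ F x u)
    (hsc : ∀ x ∈ D, ∀ u : E, |thirdD F x u| ≤ 2 * (hessQ F x u) ^ ((3 : ℝ) / 2))
    (x : E) (hx : x ∈ D) (p : E)
    (hp : ∀ v : E, hessB F x p v = ⟪gradient F x, v⟫)
    (lam : ℝ) (hlamdef : lam = Real.sqrt ⟪gradient F x, p⟫)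
    (hlam : lam < 1) :
    x - p ∈ D ∧
    ∀ q : E, (∀ v : E, hessB F (x - p) q v = ⟪gradient F (x - p), v⟫) →
      Real.sqrt ⟪gradient F (x - p), q⟫ ≤ (lam / (1 - lam)) ^ 2 := by
  have hFa : ∀ y ∈ D, ContDiffAt ℝ 3 F y := fun y hy => hF.contDiffAt (hDo.mem_nhds hy)
  simp only [hessB_eq_fderiv, hessQ_eq_fderiv, thirdD_eq_fderiv, inner_gradient_left] at *
  by_cases hp0 : p = 0
  · subst hp0
    simp only [map_zero, zero_apply] at hp
    simp only [sub_zero, ← hp]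
    exact ⟨hx, fun q _ => by simpa using sq_nonneg _⟩
  have hnn : ∀ y ∈ D, ∀ u, 0 ≤ fderiv ℝ (fderiv ℝ F) y u u := by
    intro y hy u
    by_cases hu : u = 0
    · simp [hu]
    · exact (hpos y hy u hu).le
  have hsc' : ∀ y ∈ D, ∀ u, |fderiv ℝ (fderiv ℝ (fderiv ℝ F)) y u u u| ≤
      2 * (fderiv ℝ (fderiv ℝ F) y u u * √(fderiv ℝ (fderiv ℝ F) y u u)) := by
    intro y hy u
    rw [← Real.rpow_three_halves (hnn y hy u)]
    exact hsc y hy u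
  have htri : ∀ y ∈ D, ∀ u v, fderiv ℝ (fderiv ℝ (fderiv ℝ F)) y u u v ≤
      2 * (fderiv ℝ (fderiv ℝ F) y u u * √(fderiv ℝ (fderiv ℝ F) y v v)) := fun y hy =>
    trilinear_le _ _ (hFa y hy).fderiv_fderiv_comm (hpos y hy) (hFa y hy).third_fderiv_comm_left
      (hFa y hy).third_fderiv_comm_right (hsc' y hy)
  have hpp := hpos x hx p hp0
  rw [← hp p] at hlamdef
  have ha : 0 < lam := hlamdef ▸ Real.sqrt_pos.2 hpp
  have hax : fderiv ℝ (fderiv ℝ F) x p p = lam ^ 2 := by rw [hlamdef, Real.sq_sqrt hpp.le]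
  have hmem := sub_smul_mem_of_selfConcordant hDo hclosed hFa (fun y hy => hpos y hy p hp0)
    (fun y hy => hsc' y hy p) hx ha hlam hax
  have hlen : ∀ t ∈ Set.Icc (0 : ℝ) 1,
      √(fderiv ℝ (fderiv ℝ F) (x - t • p) p p) ≤ lam * (1 - t * lam)⁻¹ := by
    intro t ht
    have hy : ∀ s ∈ Set.Icc (0 : ℝ) t, x - s • p ∈ D :=
      fun s hs => hmem s ⟨hs.1, hs.2.trans ht.2⟩
    rw [← div_eq_mul_inv]
    exact sqrt_le_of_abs_deriv_le ha hlam ht.1 ht.2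
      (r := fun s => fderiv ℝ (fderiv ℝ F) (x - s • p) p p) (by simpa using hax)
      (fun s hs => (hFa _ (hy s hs)).hasDerivAt_hess_line p p)
      (fun s hs => hpos _ (hy s hs) p hp0)
      (fun s hs => (neg_le_abs _).trans (hsc' _ (hy s hs) p))
  have hxp : x - p ∈ D := by simpa using hmem 1 ⟨zero_le_one, le_rfl⟩
  refine ⟨hxp, fun q hq => ?_⟩
  have h1 := fderiv_newton_le ha hlam hFa hmem htri hnn hlen hp q
  have h2 := hess_lower_bound ha hlam hFa hmem htri hnn hlen q
  rw [hq q] at h2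
  set m := √(fderiv ℝ F (x - p) q)
  have hm2 : m ^ 2 = fderiv ℝ F (x - p) q := Real.sq_sqrt (hq q ▸ hnn _ hxp q)
  have h1a : 0 < 1 - lam := by linarith
  have h3 : √(fderiv ℝ (fderiv ℝ F) x q q) ≤ m / (1 - lam) := by
    rw [le_div_iff₀ h1a]
    apply Real.le_sqrt_of_sq_le
    rw [mul_pow, Real.sq_sqrt (hnn x hx q)]
    exact h2
  have h4 : m ^ 2 ≤ (lam / (1 - lam)) ^ 2 * m := by
    calc m ^ 2 ≤ lam ^ 2 / (1 - lam) * (m / (1 - lam)) := by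
          rw [hm2]; exact h1.trans (mul_le_mul_of_nonneg_left h3 (by positivity))
      _ = _ := by field_simp
  rcases (Real.sqrt_nonneg _ : 0 ≤ m).eq_or_lt with h | h
  · exact h.symm.trans_le (by positivity)
  · nlinarith
end
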